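/- arXiv:1001.1474 — 2 statements merged into one kernel-verified Lean document; each statement's English description precedes it below -/
import Mathlib

section
/- Let d ≥ 2 be an integer, ε > 0, let (α,β) ∈ ℝ² be admissible with (d,α) ≠ (2,0) and μ̄ := max(2α+dβ, 2α+(d−2)β), and let f : ℝ → ℝ be twice differentiable satisfying the convexity conditions with parameter ε and strong subcritical growth. Let φ be a real-valued Schwartz function on ℝ^d with K_{α,β}(φ) < 0. Then there exists λ < 0 such that K_{α,β}(φ^λ) = 0 and H_{α,β}(φ^λ) ≤ H_{α,β}(φ), where φ^λ(x) := e^{αλ}·φ(e^{−βλ}x). -/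
noncomputable def gradN2 {d : ℕ} (u : EuclideanSpace ℝ (Fin d) → ℝ) : ℝ :=
  ∫ x, ‖fderiv ℝ u x‖^2

noncomputable def massN2 {d : ℕ} (u : EuclideanSpace ℝ (Fin d) → ℝ) : ℝ :=
  ∫ x, (u x)^2

noncomputable def Ffun {d : ℕ} (f : ℝ → ℝ) (u : EuclideanSpace ℝ (Fin d) → ℝ) : ℝ :=
  ∫ x, f (u x)

noncomputable def Jfun {d : ℕ} (f : ℝ → ℝ) (u : EuclideanSpace ℝ (Fin d) → ℝ) : ℝ :=
  (gradN2 u + massN2 u) / 2 - Ffun f u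

noncomputable def Kfun {d : ℕ} (f : ℝ → ℝ) (α β : ℝ)
    (u : EuclideanSpace ℝ (Fin d) → ℝ) : ℝ :=
  ((2*α + ((d:ℝ)-2)*β)/2) * gradN2 u + ((2*α + (d:ℝ)*β)/2) * massN2 u
    - ∫ x, (α * u x * deriv f (u x) + (d:ℝ) * β * f (u x))

noncomputable def Hfun {d : ℕ} (f : ℝ → ℝ) (α β : ℝ)
    (u : EuclideanSpace ℝ (Fin d) → ℝ) : ℝ :=
  Jfun f u - Kfun f α β u / max (2*α + (d:ℝ)*β) (2*α + ((d:ℝ)-2)*β)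

/-- The rescaled function `φ^λ(x) = e^{αλ} φ(e^{−βλ} x)`. -/
noncomputable def rescale {d : ℕ} (α β lam : ℝ) (u : EuclideanSpace ℝ (Fin d) → ℝ)
    (x : EuclideanSpace ℝ (Fin d)) : ℝ :=
  Real.exp (α * lam) * u (Real.exp (-(β * lam)) • x)

open MeasureTheory Set Filter

section Scaling

variable {d : ℕ} {α β l : ℝ} {u : EuclideanSpace ℝ (Fin d) → ℝ}

lemma integral_comp_exp_smul (l β : ℝ) (G : EuclideanSpace ℝ (Fin d) → ℝ) :
    ∫ x, G (Real.exp (-(β * l)) • x) = Real.exp (d * β * l) * ∫ x, G x := by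
  rw [Measure.integral_comp_smul, finrank_euclideanSpace_fin, ← Real.exp_nat_mul,
    ← Real.exp_neg, abs_of_pos (Real.exp_pos _), smul_eq_mul]
  congr 2
  ring

lemma integral_comp_rescale (G : ℝ → ℝ) :
    ∫ x, G (rescale α β l u x) = Real.exp (d * β * l) * ∫ x, G (Real.exp (α * l) * u x) :=
  integral_comp_exp_smul l β fun x => G (Real.exp (α * l) * u x)

lemma massN2_rescale :
    massN2 (rescale α β l u) = Real.exp ((2 * α + d * β) * l) * massN2 u := by
  unfold massN2
  rw [integral_comp_rescale fun v => v ^ 2]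
  simp only [mul_pow]
  rw [integral_const_mul, ← mul_assoc, ← Real.exp_nat_mul, ← Real.exp_add]
  congr 2
  push_cast
  ring

lemma gradN2_rescale (hu : Differentiable ℝ u) :
    gradN2 (rescale α β l u) = Real.exp ((2 * α + ((d : ℝ) - 2) * β) * l) * gradN2 u := by
  have h (x) : ‖fderiv ℝ (rescale α β l u) x‖ ^ 2 =
      Real.exp (2 * (α * l) + 2 * -(β * l)) * ‖fderiv ℝ u (Real.exp (-(β * l)) • x)‖ ^ 2 := by
    have hd : DifferentiableAt ℝ (fun x => u (Real.exp (-(β * l)) • x)) x := by fun_prop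
    have : fderiv ℝ (rescale α β l u) x =
        Real.exp (α * l) • Real.exp (-(β * l)) • fderiv ℝ u (Real.exp (-(β * l)) • x) := by
      rw [← fderiv_comp_smul, ← fderiv_const_mul hd]
      rfl
    rw [this, norm_smul, norm_smul, Real.norm_of_nonneg (Real.exp_pos _).le,
      Real.norm_of_nonneg (Real.exp_pos _).le, Real.exp_add, two_mul, two_mul, Real.exp_add,
      Real.exp_add]
    ring
  unfold gradN2
  simp only [h]
  rw [integral_const_mul, integral_comp_exp_smul l β fun x => ‖fderiv ℝ u x‖ ^ 2, ← mul_assoc,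
    ← Real.exp_add]
  congr 2
  ring

lemma Kfun_rescale (f : ℝ → ℝ) (hu : Differentiable ℝ u) :
    Kfun f α β (rescale α β l u) =
      (2 * α + ((d : ℝ) - 2) * β) / 2 * (Real.exp ((2 * α + ((d : ℝ) - 2) * β) * l) * gradN2 u) +
      (2 * α + d * β) / 2 * (Real.exp ((2 * α + d * β) * l) * massN2 u) -
      Real.exp (d * β * l) * ∫ x, (α * (Real.exp (α * l) * u x) * deriv f (Real.exp (α * l) * u x)
        + d * β * f (Real.exp (α * l) * u x)) := by
  unfold Kfun
  rw [gradN2_rescale hu, massN2_rescale,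
    integral_comp_rescale fun v => α * v * deriv f v + d * β * f v]

end Scaling

lemma massN2_nonneg {d : ℕ} (u : EuclideanSpace ℝ (Fin d) → ℝ) : 0 ≤ massN2 u :=
  integral_nonneg fun _ => sq_nonneg _

lemma gradN2_nonneg {d : ℕ} (u : EuclideanSpace ℝ (Fin d) → ℝ) : 0 ≤ gradN2 u :=
  integral_nonneg fun _ => sq_nonneg _

namespace SchwartzMap

variable {d : ℕ}

lemma integrable_abs_rpow (φ : SchwartzMap (EuclideanSpace ℝ (Fin d)) ℝ) {q : ℝ} (hq : 0 < q) :
    Integrable fun x => |φ x| ^ q := by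
  have := (φ.memLp (ENNReal.ofReal q)).integrable_norm_rpow
    (by simpa using hq) ENNReal.ofReal_ne_top
  simpa [ENNReal.toReal_ofReal hq.le] using this

lemma gradN2_pos (hd : d ≠ 0) (φ : SchwartzMap (EuclideanSpace ℝ (Fin d)) ℝ) (hφ : φ ≠ 0) :
    0 < gradN2 φ := by
  have hcont : Continuous (fun x => fderiv ℝ φ x) :=
    (SchwartzMap.fderivCLM ℝ (EuclideanSpace ℝ (Fin d)) ℝ φ).continuous
  have hint : Integrable fun x => ‖fderiv ℝ φ x‖ ^ 2 :=
    ((SchwartzMap.fderivCLM ℝ (EuclideanSpace ℝ (Fin d)) ℝ φ).memLp 2 volume).integrable_norm_pow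
      two_ne_zero
  obtain ⟨x, hx⟩ : ∃ x, fderiv ℝ φ x ≠ 0 := by
    by_contra! h
    have hc := is_const_of_fderiv_eq_zero φ.differentiable h
    have : Nonempty (Fin d) := ⟨⟨0, Nat.pos_of_ne_zero hd⟩⟩
    apply hφ
    ext x
    refine tendsto_nhds_unique (f := fun _ : EuclideanSpace ℝ (Fin d) => φ x)
      (l := cocompact _) tendsto_const_nhds ?_
    exact φ.tendsto_cocompact.congr fun y => hc y x
  exact integral_pos_of_integrable_nonneg_nonzero (by fun_prop) hint
    (fun _ => sq_nonneg _) (pow_ne_zero 2 (norm_ne_zero_iff.2 hx))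

end SchwartzMap

section PowerGrowth

variable {d : ℕ} {G : ℝ → ℝ} {C q₁ q₂ : ℝ}

lemma abs_le_of_power_growth (hC : 0 ≤ C) (hq : q₁ ≤ q₂)
    (hG : ∀ u, |G u| ≤ C * (|u| ^ q₁ + |u| ^ q₂)) {c : ℝ} (hc₀ : 0 < c) (hc₁ : c ≤ 1) (v : ℝ) :
    |G (c * v)| ≤ c ^ q₁ * (C * (|v| ^ q₁ + |v| ^ q₂)) := by
  refine (hG _).trans ?_
  rw [abs_mul, abs_of_pos hc₀, Real.mul_rpow hc₀.le (abs_nonneg v),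
    Real.mul_rpow hc₀.le (abs_nonneg v)]
  have h := Real.rpow_le_rpow_of_exponent_ge hc₀ hc₁ hq
  have := mul_le_mul_of_nonneg_right h (Real.rpow_nonneg (abs_nonneg v) q₂)
  calc C * (c ^ q₁ * |v| ^ q₁ + c ^ q₂ * |v| ^ q₂)
      ≤ C * (c ^ q₁ * |v| ^ q₁ + c ^ q₁ * |v| ^ q₂) := by gcongr
    _ = _ := by ring

lemma abs_le_of_power_growth' (hC : 0 ≤ C) (hq₁ : 0 < q₁) (hq : q₁ ≤ q₂)
    (hG : ∀ u, |G u| ≤ C * (|u| ^ q₁ + |u| ^ q₂)) {c : ℝ} (hc₀ : 0 < c) (hc₁ : c ≤ 1) (v : ℝ) :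
    |G (c * v)| ≤ C * (|v| ^ q₁ + |v| ^ q₂) := by
  refine (abs_le_of_power_growth hC hq hG hc₀ hc₁ v).trans ?_
  exact mul_le_of_le_one_left (by positivity) (Real.rpow_le_one hc₀.le hc₁ hq₁.le)

lemma integrable_power_bound (φ : SchwartzMap (EuclideanSpace ℝ (Fin d)) ℝ)
    (hq₁ : 0 < q₁) (hq : q₁ ≤ q₂) (C : ℝ) :
    Integrable fun x => C * (|φ x| ^ q₁ + |φ x| ^ q₂) :=
  ((φ.integrable_abs_rpow hq₁).add (φ.integrable_abs_rpow (hq₁.trans_le hq))).const_mul C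

lemma integrable_comp_of_power_growth (φ : SchwartzMap (EuclideanSpace ℝ (Fin d)) ℝ)
    (hGc : Continuous G) (hC : 0 ≤ C) (hq₁ : 0 < q₁) (hq : q₁ ≤ q₂)
    (hG : ∀ u, |G u| ≤ C * (|u| ^ q₁ + |u| ^ q₂)) {c : ℝ} (hc₀ : 0 < c) (hc₁ : c ≤ 1) :
    Integrable fun x => G (c * φ x) :=
  (integrable_power_bound φ hq₁ hq C).mono'
    (hGc.comp (continuous_const.mul φ.continuous)).aestronglyMeasurable
    (ae_of_all _ fun x => abs_le_of_power_growth' hC hq₁ hq hG hc₀ hc₁ (φ x))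

lemma abs_integral_comp_le_of_power_growth (φ : SchwartzMap (EuclideanSpace ℝ (Fin d)) ℝ)
    (hC : 0 ≤ C) (hq₁ : 0 < q₁) (hq : q₁ ≤ q₂)
    (hG : ∀ u, |G u| ≤ C * (|u| ^ q₁ + |u| ^ q₂)) {c : ℝ} (hc₀ : 0 < c) (hc₁ : c ≤ 1) :
    |∫ x, G (c * φ x)| ≤ c ^ q₁ * ∫ x, C * (|φ x| ^ q₁ + |φ x| ^ q₂) := by
  rw [← integral_const_mul]
  exact norm_integral_le_of_norm_le (f := fun x => G (c * φ x)) ((integrable_power_bound φ hq₁ hq C).const_mul _)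
    (ae_of_all _ fun x => abs_le_of_power_growth hC hq hG hc₀ hc₁ (φ x))

lemma continuousOn_integral_comp_exp_mul (φ : SchwartzMap (EuclideanSpace ℝ (Fin d)) ℝ)
    (hGc : Continuous G) (hC : 0 ≤ C) (hq₁ : 0 < q₁) (hq : q₁ ≤ q₂)
    (hG : ∀ u, |G u| ≤ C * (|u| ^ q₁ + |u| ^ q₂)) {α : ℝ} (hα : 0 ≤ α) :
    ContinuousOn (fun l => ∫ x, G (Real.exp (α * l) * φ x)) (Iic 0) := by
  refine continuousOn_of_dominated (bound := fun x => C * (|φ x| ^ q₁ + |φ x| ^ q₂))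
    (fun l _ => (hGc.comp (continuous_const.mul φ.continuous)).aestronglyMeasurable)
    (fun l hl => ae_of_all _ fun x => ?_) (integrable_power_bound φ hq₁ hq C)
    (ae_of_all _ fun x => by fun_prop)
  exact abs_le_of_power_growth' hC hq₁ hq hG (Real.exp_pos _)
    (Real.exp_le_one_iff.2 (mul_nonpos_of_nonneg_of_nonpos hα hl)) (φ x)

end PowerGrowth

/-- With `D u = u * d/du` and `L = α * D + b`, the convexity conditions `(D - p) f ≥ 0` and
`(D - 2) (D - p) f ≥ 0` give `L (L - μ) f ≥ 0`, so that `(L - μ) f` increases under scaling. -/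
lemma monotone_scaled_of_convexity {f : ℝ → ℝ} (hf1 : Differentiable ℝ f)
    (hf2 : Differentiable ℝ (deriv f)) (hpos : ∀ u, 0 ≤ f u) {p α b μ : ℝ}
    (hconv1 : ∀ u, p * f u ≤ u * deriv f u)
    (hconv2 : ∀ u, 0 ≤ u ^ 2 * deriv (deriv f) u - (1 + p) * (u * deriv f u) + 2 * p * f u)
    (hα : 0 ≤ α) (hb : 0 ≤ 2 * α + b) (hpb : 0 ≤ α * p + b) (hμ : μ ≤ α * p + b) (u : ℝ) :
    Monotone fun l => Real.exp (b * l) *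
      (α * (Real.exp (α * l) * u) * deriv f (Real.exp (α * l) * u)
        + (b - μ) * f (Real.exp (α * l) * u)) := by
  refine monotone_of_hasDerivAt_nonneg (f' := fun l =>
    let v := Real.exp (α * l) * u
    Real.exp (b * l) * (b * (α * v * deriv f v + (b - μ) * f v)
      + α * v * (α * deriv f v + α * v * deriv (deriv f) v + (b - μ) * deriv f v))) ?_ ?_
  · intro l
    have hexp (a : ℝ) : HasDerivAt (fun l => Real.exp (a * l)) (Real.exp (a * l) * a) l := by
      simpa using ((hasDerivAt_id l).const_mul a).exp
    have hv : HasDerivAt (fun l => Real.exp (α * l) * u) (Real.exp (α * l) * α * u) l :=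
      (hexp α).mul_const u
    have h0 := (hf1 (Real.exp (α * l) * u)).hasDerivAt.comp l hv
    have h1 := (hf2 (Real.exp (α * l) * u)).hasDerivAt.comp l hv
    refine ((hexp b).mul (((hv.const_mul α).mul h1).add (h0.const_mul (b - μ)))).congr_deriv ?_
    simp only [Function.comp_apply, Pi.add_apply, Pi.mul_apply]
    ring
  · intro l
    refine mul_nonneg (Real.exp_pos _).le ?_
    set v := Real.exp (α * l) * u
    have e1 := mul_nonneg (sq_nonneg α) (hconv2 v)
    have e2 := mul_nonneg (mul_nonneg hα (by linarith : 0 ≤ (2 * α + b) + (α * p + b - μ)))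
      (sub_nonneg.2 (hconv1 v))
    have e3 := mul_nonneg (mul_nonneg hpb (sub_nonneg.2 hμ)) (hpos v)
    linarith

theorem stmt10 (d : ℕ) (hd : 2 ≤ d) (ε α β : ℝ) (hε : 0 < ε)
    (hα : 0 ≤ α) (h1 : 0 ≤ 2*α + (d:ℝ)*β) (h2 : 0 ≤ 2*α + ((d:ℝ)-2)*β)
    (hne : (α, β) ≠ (0, 0)) (hda : ¬ (d = 2 ∧ α = 0))
    (f : ℝ → ℝ) (hf1 : Differentiable ℝ f) (hf2 : Differentiable ℝ (deriv f))
    (hpos : ∀ u : ℝ, 0 ≤ f u)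
    (hconv1 : ∀ u : ℝ, (2 + 4/(d:ℝ) + ε) * f u ≤ u * deriv f u)
    (hconv2 : ∀ u : ℝ, 0 ≤ u^2 * deriv (deriv f) u
        - (1 + (2 + 4/(d:ℝ) + ε)) * (u * deriv f u) + 2 * (2 + 4/(d:ℝ) + ε) * f u)
    (hgrowth : ∃ C > 0, ∃ q₁ q₂ : ℝ, 2 + 4/(d:ℝ) < q₁ ∧ q₁ ≤ q₂ ∧
        (3 ≤ d → q₂ ≤ 2 + 4/((d:ℝ)-2)) ∧
        ∀ u : ℝ, |f u| + |u * deriv f u| + |u^2 * deriv (deriv f) u|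
          ≤ C * (|u| ^ q₁ + |u| ^ q₂))
    (φ : SchwartzMap (EuclideanSpace ℝ (Fin d)) ℝ)
    (hK : Kfun f α β ⇑φ < 0) :
    ∃ lam < 0, Kfun f α β (rescale α β lam ⇑φ) = 0 ∧
      Hfun f α β (rescale α β lam ⇑φ) ≤ Hfun f α β ⇑φ := by
  obtain ⟨C, hC, q₁, q₂, hq₁, hq, -, hgr⟩ := hgrowth
  have hd0 : (0 : ℝ) < d := by exact_mod_cast (by omega : 0 < d)
  have hd2 : (2 : ℝ) ≤ d := by exact_mod_cast hd
  have h4d : 0 < 4 / (d : ℝ) := by positivity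
  have hq₁0 : 0 < q₁ := by linarith
  have h4 : 4 / (d : ℝ) * α + 2 * β = 2 / d * (2 * α + d * β) := by field_simp; ring
  have h4n : 0 ≤ 4 / (d : ℝ) * α + 2 * β := by rw [h4]; positivity
  set a := 2 * α + ((d : ℝ) - 2) * β with ha_def
  set b := 2 * α + (d : ℝ) * β with hb_def
  have ha : 0 < a := by
    refine h2.lt_of_ne' fun h0 => ?_
    have hβ : β ≤ 0 := by
      by_contra! hβ
      have : 0 ≤ ((d : ℝ) - 2) * β := mul_nonneg (by linarith) hβ.le
      have hα0 : α = 0 := by linarith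
      have : ((d : ℝ) - 2) * β = 0 := by linarith
      rcases mul_eq_zero.1 this with h | h
      · exact hda ⟨by exact_mod_cast (by linarith : (d : ℝ) = 2), hα0⟩
      · exact hβ.ne' h
    have hβ0 : β = 0 := by linarith
    exact hne (by rw [Prod.mk.injEq]; exact ⟨by rw [hβ0] at ha_def; linarith, hβ0⟩)
  have hgap : 0 < d * β + α * q₁ - a := by
    rcases hα.eq_or_lt with h | h
    · have hβ : 0 < β := by
        refine lt_of_le_of_ne ?_ fun h' => hne (by rw [← h, ← h'])
        nlinarith
      rw [ha_def, ← h]; linarith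
    · have := mul_lt_mul_of_pos_left hq₁ h
      rw [ha_def]; linarith
  have hgrow_f (u : ℝ) : |f u| ≤ C * (|u| ^ q₁ + |u| ^ q₂) :=
    le_trans (by linarith [abs_nonneg (u * deriv f u), abs_nonneg (u ^ 2 * deriv (deriv f) u)])
      (hgr u)
  have hgrow_Df (u : ℝ) : |u * deriv f u| ≤ C * (|u| ^ q₁ + |u| ^ q₂) :=
    le_trans (by linarith [abs_nonneg (f u), abs_nonneg (u ^ 2 * deriv (deriv f) u)]) (hgr u)
  let g (u : ℝ) : ℝ := α * u * deriv f u + d * β * f u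
  have hgc : Continuous g := by
    have := hf1.continuous
    have := hf2.continuous
    fun_prop
  have hC' : 0 ≤ (α + |d * β|) * C := by positivity
  have hgg (u : ℝ) : |g u| ≤ (α + |d * β|) * C * (|u| ^ q₁ + |u| ^ q₂) := by
    calc |g u| ≤ |α * u * deriv f u| + |d * β * f u| := abs_add_le _ _
      _ = α * |u * deriv f u| + |d * β| * |f u| := by
        rw [mul_assoc α, abs_mul α, abs_of_nonneg hα, abs_mul (d * β)]
      _ ≤ α * (C * (|u| ^ q₁ + |u| ^ q₂)) + |d * β| * (C * (|u| ^ q₁ + |u| ^ q₂)) := by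
        gcongr
        · exact hgrow_Df u
        · exact hgrow_f u
      _ = _ := by ring
  have hexp {l : ℝ} (hl : l ≤ 0) : Real.exp (α * l) ≤ 1 :=
    Real.exp_le_one_iff.2 (mul_nonpos_of_nonneg_of_nonpos hα hl)
  have hKl (l : ℝ) : Kfun f α β (rescale α β l φ) =
      a / 2 * (Real.exp (a * l) * gradN2 φ) + b / 2 * (Real.exp (b * l) * massN2 φ) -
      Real.exp (d * β * l) * ∫ x, g (Real.exp (α * l) * φ x) :=
    Kfun_rescale f φ.differentiable
  have hresc : rescale α β 0 φ = φ := by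
    ext x
    simp [rescale]
  have hφ : φ ≠ 0 := by
    rintro rfl
    have hg0 : g 0 = 0 := by
      have := hgg 0
      rw [abs_zero, Real.zero_rpow hq₁0.ne', Real.zero_rpow (hq₁0.trans_le hq).ne'] at this
      simpa using this
    have := hKl 0
    rw [hresc] at this
    simp [hg0, gradN2, massN2] at this
    simp [this] at hK
  have hG : 0 < gradN2 φ := φ.gradN2_pos (by omega) hφ
  have hKcont : ContinuousOn (fun l => Kfun f α β (rescale α β l φ)) (Iic 0) := by
    simp only [hKl]
    refine ContinuousOn.sub (by fun_prop) (ContinuousOn.mul (by fun_prop) ?_)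
    exact continuousOn_integral_comp_exp_mul φ hgc hC' hq₁0 hq hgg hα
  obtain ⟨l₀, hl₀, hKl₀⟩ : ∃ l₀ < 0, 0 < Kfun f α β (rescale α β l₀ φ) := by
    set B := ∫ x, (α + |d * β|) * C * (|φ x| ^ q₁ + |φ x| ^ q₂)
    have hlim : Tendsto (fun l => Real.exp ((d * β + α * q₁ - a) * l) * B) atBot (nhds 0) := by
      simpa using (Real.tendsto_exp_atBot.comp
        (tendsto_id.const_mul_atBot hgap)).mul_const B
    obtain ⟨l, hl, hl0⟩ := ((hlim.eventually_lt_const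
      (by positivity : 0 < a / 2 * gradN2 φ)).and (eventually_lt_atBot 0)).exists
    refine ⟨l, hl0, ?_⟩
    have hI := (le_abs_self _).trans (abs_integral_comp_le_of_power_growth φ hC' hq₁0 hq hgg
      (Real.exp_pos (α * l)) (hexp hl0.le))
    have hM : 0 ≤ b / 2 * (Real.exp (b * l) * massN2 φ) :=
      mul_nonneg (by linarith) (mul_nonneg (Real.exp_pos _).le (massN2_nonneg _))
    have hE := mul_lt_mul_of_pos_left hl (Real.exp_pos (a * l))
    have hI' := mul_le_mul_of_nonneg_left hI (Real.exp_pos (d * β * l)).le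
    have heq : Real.exp (d * β * l) * (Real.exp (α * l) ^ q₁ * B) =
        Real.exp (a * l) * (Real.exp ((d * β + α * q₁ - a) * l) * B) := by
      rw [← Real.exp_mul, ← mul_assoc, ← mul_assoc, ← Real.exp_add, ← Real.exp_add]
      congr 2
      ring
    rw [hKl]
    linarith
  obtain ⟨l, ⟨hl₁, hl₂⟩, hl⟩ : (0 : ℝ) ∈ (fun l => Kfun f α β (rescale α β l φ)) '' Ioo l₀ 0 :=
    intermediate_value_Ioo' hl₀.le (hKcont.mono Icc_subset_Iic_self)
      ⟨by simpa [hresc] using hK, hKl₀⟩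
  refine ⟨l, hl₂, hl, ?_⟩
  set μ := max b a with hμ_def
  have hμ : 0 < μ := ha.trans_le (le_max_right _ _)
  let h (u : ℝ) : ℝ := α * u * deriv f u + (d * β - μ) * f u
  have hf_int {l : ℝ} (hl : l ≤ 0) : Integrable fun x => f (Real.exp (α * l) * φ x) :=
    integrable_comp_of_power_growth φ hf1.continuous hC.le hq₁0 hq hgrow_f (Real.exp_pos _)
      (hexp hl)
  have hg_int {l : ℝ} (hl : l ≤ 0) : Integrable fun x => g (Real.exp (α * l) * φ x) :=
    integrable_comp_of_power_growth φ hgc hC' hq₁0 hq hgg (Real.exp_pos _) (hexp hl)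
  have hh_eq : h = fun u => g u - μ * f u := by
    ext u
    simp only [h, g]
    ring
  have hh_int {l : ℝ} (hl : l ≤ 0) : Integrable fun x => h (Real.exp (α * l) * φ x) := by
    rw [hh_eq]
    exact (hg_int hl).sub ((hf_int hl).const_mul μ)
  have hHl {l : ℝ} (hl : l ≤ 0) : Hfun f α β (rescale α β l φ) =
      (1 / 2 - a / (2 * μ)) * (Real.exp (a * l) * gradN2 φ) +
      (1 / 2 - b / (2 * μ)) * (Real.exp (b * l) * massN2 φ) +
      (∫ x, Real.exp (d * β * l) * h (Real.exp (α * l) * φ x)) / μ := by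
    unfold Hfun Jfun
    rw [hKl, gradN2_rescale φ.differentiable, massN2_rescale, Ffun, integral_comp_rescale f,
      integral_const_mul, hh_eq, integral_sub (hg_int hl) ((hf_int hl).const_mul μ),
      integral_const_mul]
    rw [← ha_def, ← hb_def, ← hμ_def]
    field_simp
    ring
  have hmono : (∫ x, Real.exp (d * β * l) * h (Real.exp (α * l) * φ x)) ≤
      ∫ x, Real.exp (d * β * 0) * h (Real.exp (α * 0) * φ x) := by
    refine integral_mono ((hh_int hl₂.le).const_mul _) ((hh_int le_rfl).const_mul _) fun x => ?_
    have hp : 0 ≤ α * ε := by positivity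
    have hαp : α * (2 + 4 / (d : ℝ) + ε) + d * β = b + 4 / d * α + α * ε := by
      rw [hb_def]; ring
    have h4α : 0 ≤ 4 / (d : ℝ) * α := by positivity
    refine monotone_scaled_of_convexity hf1 hf2 hpos hconv1 hconv2 hα h1 ?_ ?_ (φ x) hl₂.le
    · rw [hαp]; linarith
    · rw [hαp]; exact max_le (by linarith) (by rw [ha_def]; linarith)
  have hcoef {c : ℝ} (hc : c ≤ μ) : 0 ≤ 1 / 2 - c / (2 * μ) := by
    rw [sub_nonneg, div_le_div_iff₀ (by positivity) two_pos]
    linarith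
  have hexp0 {c : ℝ} (hc : 0 ≤ c) : Real.exp (c * l) ≤ Real.exp (c * 0) :=
    Real.exp_le_exp.2 (mul_le_mul_of_nonneg_left hl₂.le hc)
  have key : Hfun f α β (rescale α β l φ) ≤ Hfun f α β (rescale α β 0 φ) := by
    rw [hHl hl₂.le, hHl le_rfl]
    have := hcoef (le_max_right b a)
    have := hcoef (le_max_left b a)
    have := massN2_nonneg φ
    gcongr ?_ * (?_ * _) + ?_ * (?_ * _) + ?_ / _
    · exact hexp0 ha.le
    · exact hexp0 h1
  rwa [hresc] at key
end

section
/- Let d ≥ 1 be an integer and let f : ℝ → ℝ be differentiable with f(u) ≥ 0 and u·f′(u) ≥ (2+4/d)·f(u) for all u ∈ ℝ, and suppose there are C > 0 and q ≥ 2 with |f(u)| + |u·f′(u)| ≤ C(|u|² + |u|^q) for all u. Let u₀, u₁ be real-valued Schwartz functions on ℝ^d and suppose K_{1,0}(u₀) := ∫_{ℝ^d}(|∇u₀|² + u₀² − u₀·f′(u₀)) dx ≥ 0. Then J(u₀) ≤ (1/2)∫(|∇u₀|² + u₀²) dx ≤ (1+d/2)·J(u₀), and E(u₀,u₁) ≤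 E^Q(u₀,u₁) ≤ (1+d/2)·E(u₀,u₁). -/
lemma SchwartzMap.integrable_norm_sq {E F : Type*} [NormedAddCommGroup E] [NormedSpace ℝ E]
    [NormedAddCommGroup F] [NormedSpace ℝ F] [MeasurableSpace E] [BorelSpace E]
    [SecondCountableTopology E] (μ : MeasureTheory.Measure E) [μ.HasTemperateGrowth]
    (g : SchwartzMap E F) :
    MeasureTheory.Integrable (fun x => ‖g x‖ ^ 2) μ := by
  simpa using (g.memLp 2 μ).integrable_norm_pow (by norm_num)

lemma SchwartzMap.integrable_norm_rpow {E F : Type*} [NormedAddCommGroup E] [NormedSpace ℝ E]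
    [NormedAddCommGroup F] [NormedSpace ℝ F] [MeasurableSpace E] [BorelSpace E]
    [SecondCountableTopology E] (μ : MeasureTheory.Measure E) [μ.HasTemperateGrowth]
    (g : SchwartzMap E F) {q : ℝ} (hq : 0 < q) :
    MeasureTheory.Integrable (fun x => ‖g x‖ ^ q) μ := by
  have h := (g.memLp (ENNReal.ofReal q) μ).integrable_norm_rpow (by simpa using hq)
    ENNReal.ofReal_ne_top
  simpa [ENNReal.toReal_ofReal hq.le] using h


theorem stmt12 (d : ℕ) (hd : 1 ≤ d)
    (f : ℝ → ℝ) (hf : Differentiable ℝ f)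
    (hpos : ∀ u : ℝ, 0 ≤ f u)
    (hD : ∀ u : ℝ, (2 + 4/(d:ℝ)) * f u ≤ u * deriv f u)
    (C q : ℝ) (hC : 0 < C) (hq : 2 ≤ q)
    (hbound : ∀ u : ℝ, |f u| + |u * deriv f u| ≤ C * (|u| ^ (2:ℝ) + |u| ^ q))
    (u₀ u₁ : SchwartzMap (EuclideanSpace ℝ (Fin d)) ℝ)
    (hK : 0 ≤ ∫ x, (‖fderiv ℝ (⇑u₀) x‖^2 + (u₀ x)^2 - u₀ x * deriv f (u₀ x))) :
    (((1/2) * (∫ x, (‖fderiv ℝ (⇑u₀) x‖^2 + (u₀ x)^2)) - (∫ x, f (u₀ x))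
        ≤ (1/2) * (∫ x, (‖fderiv ℝ (⇑u₀) x‖^2 + (u₀ x)^2)))
      ∧ ((1/2) * (∫ x, (‖fderiv ℝ (⇑u₀) x‖^2 + (u₀ x)^2))
        ≤ (1 + (d:ℝ)/2)
          * ((1/2) * (∫ x, (‖fderiv ℝ (⇑u₀) x‖^2 + (u₀ x)^2)) - (∫ x, f (u₀ x)))))
    ∧ (((1/2) * (∫ x, ((u₁ x)^2 + ‖fderiv ℝ (⇑u₀) x‖^2 + (u₀ x)^2)) - (∫ x, f (u₀ x))
        ≤ (1/2) * (∫ x, ((u₁ x)^2 + ‖fderiv ℝ (⇑u₀) x‖^2 + (u₀ x)^2)))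
      ∧ ((1/2) * (∫ x, ((u₁ x)^2 + ‖fderiv ℝ (⇑u₀) x‖^2 + (u₀ x)^2))
        ≤ (1 + (d:ℝ)/2)
          * ((1/2) * (∫ x, ((u₁ x)^2 + ‖fderiv ℝ (⇑u₀) x‖^2 + (u₀ x)^2))
            - (∫ x, f (u₀ x))))) := by
  have hu0 : MeasureTheory.Integrable (fun x => (u₀ x) ^ 2) := by
    simpa using u₀.integrable_norm_sq MeasureTheory.volume
  have hu1 : MeasureTheory.Integrable (fun x => (u₁ x) ^ 2) := by
    simpa using u₁.integrable_norm_sq MeasureTheory.volume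
  have hgrad : MeasureTheory.Integrable (fun x => ‖fderiv ℝ (⇑u₀) x‖ ^ 2) := by
    simpa using (SchwartzMap.fderivCLM ℝ _ _ u₀).integrable_norm_sq MeasureTheory.volume
  have hgrad_add : MeasureTheory.Integrable
      (fun x => ‖fderiv ℝ (⇑u₀) x‖ ^ 2 + (u₀ x) ^ 2) := hgrad.add hu0
  have hmaj : MeasureTheory.Integrable
      (fun x => C * (|u₀ x| ^ (2 : ℝ) + |u₀ x| ^ q)) := by
    have h2 := u₀.integrable_norm_rpow MeasureTheory.volume (q := 2) two_pos
    have hq' := u₀.integrable_norm_rpow MeasureTheory.volume (q := q) (by linarith)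
    exact (h2.add hq').const_mul C
  have hF : MeasureTheory.Integrable (fun x => f (u₀ x)) := by
    refine hmaj.mono' (hf.continuous.comp u₀.continuous).aestronglyMeasurable
      (Filter.Eventually.of_forall fun x => ?_)
    rw [Real.norm_eq_abs]
    linarith [hbound (u₀ x), abs_nonneg (u₀ x * deriv f (u₀ x))]
  have hG : MeasureTheory.Integrable (fun x => u₀ x * deriv f (u₀ x)) := by
    have hm : Measurable (fun x => u₀ x * deriv f (u₀ x)) :=
      u₀.continuous.measurable.mul ((measurable_deriv f).comp u₀.continuous.measurable)
    refine hmaj.mono' hm.aestronglyMeasurable (Filter.Eventually.of_forall fun x => ?_)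
    rw [Real.norm_eq_abs]
    linarith [hbound (u₀ x), abs_nonneg (f (u₀ x))]
  have hFG : (2 + 4 / (d : ℝ)) * ∫ x, f (u₀ x) ≤ ∫ x, u₀ x * deriv f (u₀ x) := by
    rw [← MeasureTheory.integral_const_mul]
    exact MeasureTheory.integral_mono (hF.const_mul _) hG fun x => hD (u₀ x)
  have hF0 : 0 ≤ ∫ x, f (u₀ x) := MeasureTheory.integral_nonneg fun x => hpos (u₀ x)
  have hA0 : 0 ≤ ∫ x, (u₁ x) ^ 2 := MeasureTheory.integral_nonneg fun x => sq_nonneg (u₁ x)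
  rw [MeasureTheory.integral_sub hgrad_add hG] at hK
  have hsplit : ∫ x, ((u₁ x) ^ 2 + ‖fderiv ℝ (⇑u₀) x‖ ^ 2 + (u₀ x) ^ 2)
      = (∫ x, (u₁ x) ^ 2) + ∫ x, (‖fderiv ℝ (⇑u₀) x‖ ^ 2 + (u₀ x) ^ 2) := by
    rw [← MeasureTheory.integral_add hu1 hgrad_add]
    simp only [add_assoc]
  rw [hsplit]
  set S := ∫ x, (‖fderiv ℝ (⇑u₀) x‖ ^ 2 + (u₀ x) ^ 2)
  set F := ∫ x, f (u₀ x)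
  set A := ∫ x, (u₁ x) ^ 2
  have hK' : (∫ x, u₀ x * deriv f (u₀ x)) ≤ S := sub_nonneg.mp hK
  have hd0 : (0 : ℝ) < d := by exact_mod_cast hd
  have hkey : (2 * d + 4) * F ≤ d * S := by
    have h := mul_le_mul_of_nonneg_left (hFG.trans hK') hd0.le
    have he : (d : ℝ) * ((2 + 4 / d) * F) = (2 * d + 4) * F := by field_simp
    linarith
  have hdA : 0 ≤ d * A := mul_nonneg hd0.le hA0
  refine ⟨⟨?_, ?_⟩, ?_, ?_⟩ <;> nlinarith
end
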